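/- Let h and n be non-negative integers with n ≥ h and h+n even, and let k_1 ≤ k_2 ≤ … ≤ k_n be integers. Then GT_h(k_1,…,k_n) equals the Pfaffian of the upper triangular array of order n+h whose entries are A_{i,j} = gt_h(k_i+i, k_j+j) for 1 ≤ i < j ≤ n, A_{i,n+j} = binom(k_i+i, h−j) for 1 ≤ i ≤ n and 1 ≤ j ≤ h, and A_{n+i,n+j} = 0 for 1 ≤ i < j ≤ h. -/

import Mathlib

open MvPolynomial

noncomputable section

/-- The generalized binomial coefficient `binom(x,m) = x(x-1)⋯(x-m+1)/m!`. -/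
def qbinom (x : ℚ) (m : ℕ) : ℚ := (∏ j ∈ Finset.range m, (x - j)) / m.factorial

/-- `gtChar gt` says that `gt h` is the (unique) bivariate polynomial `gt_h(x,y)`:
`gt_0 = 1` and for `h ≥ 1`, `gt_h` agrees with the defining sum for all integers `x ≥ h`. -/
def gtChar (gt : ℕ → MvPolynomial (Fin 2) ℚ) : Prop :=
  gt 0 = 1 ∧
    ∀ h : ℕ, 1 ≤ h → ∀ x y : ℤ, (h : ℤ) ≤ x →
      MvPolynomial.eval ![(x : ℚ), (y : ℚ)] (gt h) =
        ∑ p ∈ Finset.Icc (h : ℤ) (x - 1),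
          (qbinom ((x : ℚ) - (p : ℚ) + (h : ℚ) - 1) h * qbinom ((y : ℚ) - (p : ℚ) + (h : ℚ) - 2) h -
            qbinom ((x : ℚ) - (p : ℚ) + (h : ℚ) - 2) h * qbinom ((y : ℚ) - (p : ℚ) + (h : ℚ) - 1) h)

/-- Skew-symmetric extension of an upper triangular array. -/
def skewExt {R : Type*} [Ring R] {N : ℕ} (A : Fin N → Fin N → R) : Fin N → Fin N → R :=
  fun i j => if i < j then A i j else if j < i then -A j i else 0

/-- The Pfaffian of an upper triangular array of (even) order `N`, computed via the
skew-symmetric extension and the standard formula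
`Pf(A) = (2^m m!)⁻¹ ∑_{σ ∈ S_{2m}} sgn(σ) ∏_i A_{σ(2i-1),σ(2i)}`, which for skew-symmetric
matrices agrees with the sum over perfect matchings. -/
def pfUpper {R : Type*} [CommRing R] [Algebra ℚ R] (N : ℕ) (A : Fin N → Fin N → R) : R :=
  ((2 ^ (N / 2) * (N / 2).factorial : ℚ)⁻¹) •
    ∑ σ : Equiv.Perm (Fin N),
      (Equiv.Perm.sign σ : ℤ) •
        ∏ i : Fin (N / 2),
          skewExt A (σ ⟨2 * i.val, by have := i.isLt; omega⟩)
            (σ ⟨2 * i.val + 1, by have := i.isLt; omega⟩)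

/-- Index set of an `(h,n)`-trapezoidal array: rows `r = 0,…,h`, row `r` having
`n - h + r` entries (so the bottom row `r = h` has `n` entries). -/
def GTIdx (h n : ℕ) : Type := {p : ℕ × ℕ // p.1 ≤ h ∧ p.2 < n - h + p.1}

def mkIdx (h n r c : ℕ) (hr : r ≤ h) (hc : c < n - h + r) : GTIdx h n := ⟨(r, c), hr, hc⟩

/-- The Gelfand–Tsetlin trapezoid conditions: `a (r+1) c ≤ a r c ≤ a (r+1) (c+1)`. -/
def IsGT (h n : ℕ) (a : GTIdx h n → ℤ) : Prop :=
  ∀ (r c : ℕ) (_ : r < h) (hc : c < n - h + r),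
    a (mkIdx h n (r+1) c (by omega) (by omega)) ≤ a (mkIdx h n r c (by omega) hc) ∧
    a (mkIdx h n r c (by omega) hc) ≤ a (mkIdx h n (r+1) (c+1) (by omega) (by omega))

/-- The number of `(h,n)`-Gelfand–Tsetlin trapezoids with prescribed bottom row `k`. -/
def GTcount (h n : ℕ) (k : Fin n → ℤ) : ℕ :=
  Nat.card {a : GTIdx h n → ℤ //
    IsGT h n a ∧ ∀ i : Fin n, a (mkIdx h n h i.val le_rfl (by have := i.isLt; omega)) = k i}

/-- The left position `2i` of the `i`-th pair in `Fin N`, `N = 2m`. -/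
def pairLeft {N m : ℕ} (hN : N = 2 * m) (i : Fin m) : Fin N := ⟨2 * i.val, by omega⟩

/-- The right position `2i+1` of the `i`-th pair in `Fin N`, `N = 2m`. -/
def pairRight {N m : ℕ} (hN : N = 2 * m) (i : Fin m) : Fin N := ⟨2 * i.val + 1, by omega⟩

/-- `Fin (2m)` as a disjoint union of `m` consecutive pairs. -/
def pairEquiv {N m : ℕ} (hN : N = 2 * m) : Fin m × Bool ≃ Fin N where
  toFun p := if p.2 then pairRight hN p.1 else pairLeft hN p.1
  invFun a := (⟨a.val / 2, by omega⟩, decide (a.val % 2 = 1))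
  left_inv := by
    rintro ⟨i, b⟩
    cases b <;> (simp [pairLeft, pairRight, Fin.ext_iff]; try omega)
  right_inv := by
    intro a
    by_cases h : a.val % 2 = 1 <;> simp [pairLeft, pairRight, Fin.ext_iff, h] <;> omega

/-- `2^m m!` times the Pfaffian of a skew-symmetric array `S` of order `N = 2m`. -/
def pfSum {N m : ℕ} (hN : N = 2 * m) (S : Fin N → Fin N → ℚ) : ℚ :=
  ∑ σ : Equiv.Perm (Fin N), ((Equiv.Perm.sign σ : ℤ) : ℚ) *
    ∏ i : Fin m, S (σ (pairLeft hN i)) (σ (pairRight hN i))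

theorem prod_pairs {N m : ℕ} (hN : N = 2 * m) (u : Fin N → ℚ) :
    ∏ i : Fin m, u (pairLeft hN i) * u (pairRight hN i) = ∏ a, u a := by
  rw [← (pairEquiv hN).prod_comp, Fintype.prod_prod_type]
  refine Finset.prod_congr rfl fun i _ => ?_
  simp [pairEquiv, mul_comm]

theorem sum_piFinset_prod_pairs {N m : ℕ} (hN : N = 2 * m) {Z : Type*} (Y : Fin N → Finset Z)
    (g : Fin N → Z → Fin N → Z → ℚ) (σ : Equiv.Perm (Fin N)) :
    ∑ f ∈ Fintype.piFinset Y, ∏ i : Fin m,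
        g (σ (pairLeft hN i)) (f (σ (pairLeft hN i)))
          (σ (pairRight hN i)) (f (σ (pairRight hN i))) =
      ∏ i : Fin m, ∑ s ∈ Y (σ (pairLeft hN i)), ∑ t ∈ Y (σ (pairRight hN i)),
        g (σ (pairLeft hN i)) s (σ (pairRight hN i)) t := by
  simp_rw [← Finset.sum_product']
  rw [Finset.prod_univ_sum]
  have hl : ∀ i, (pairEquiv hN).symm (pairLeft hN i) = (i, false) := fun i => by
    rw [Equiv.symm_apply_eq]; simp [pairEquiv]
  have hr : ∀ i, (pairEquiv hN).symm (pairRight hN i) = (i, true) := fun i => by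
    rw [Equiv.symm_apply_eq]; simp [pairEquiv]
  have hcases : ∀ a : Fin N, ∃ i, a = σ (pairLeft hN i) ∨ a = σ (pairRight hN i) := by
    intro a
    obtain ⟨⟨i, b⟩, hb⟩ := (pairEquiv hN).surjective (σ.symm a)
    refine ⟨i, ?_⟩
    cases b
    · left; exact (Equiv.symm_apply_eq σ).mp (by simpa [pairEquiv] using hb.symm)
    · right; exact (Equiv.symm_apply_eq σ).mp (by simpa [pairEquiv] using hb.symm)
  refine Finset.sum_nbij'
    (fun f i => (f (σ (pairLeft hN i)), f (σ (pairRight hN i))))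
    (fun p a => if ((pairEquiv hN).symm (σ.symm a)).2
      then (p ((pairEquiv hN).symm (σ.symm a)).1).2
      else (p ((pairEquiv hN).symm (σ.symm a)).1).1) ?_ ?_ ?_ ?_ ?_
  · intro f hf
    simp only [Fintype.mem_piFinset, Finset.mem_product] at hf ⊢
    exact fun i => ⟨hf _, hf _⟩
  · intro p hp
    simp only [Fintype.mem_piFinset, Finset.mem_product] at hp ⊢
    intro a
    obtain ⟨i, rfl | rfl⟩ := hcases a
    · simpa [hl] using (hp i).1
    · simpa [hr] using (hp i).2
  · intro f _
    funext a
    obtain ⟨i, rfl | rfl⟩ := hcases a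
    · simp [hl]
    · simp [hr]
  · intro p _
    funext i
    simp [hl, hr]
  · intro f _
    rfl

/-- Multilinearity of the Pfaffian in its rows and columns. -/
theorem sum_piFinset_pfSum {N m : ℕ} (hN : N = 2 * m) {Z : Type*} (Y : Fin N → Finset Z)
    (g : Fin N → Z → Fin N → Z → ℚ) :
    ∑ f ∈ Fintype.piFinset Y, pfSum hN (fun a b => g a (f a) b (f b)) =
      pfSum hN (fun a b => ∑ s ∈ Y a, ∑ t ∈ Y b, g a s b t) := by
  unfold pfSum
  rw [Finset.sum_comm]
  refine Finset.sum_congr rfl fun σ _ => ?_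
  rw [← Finset.mul_sum, sum_piFinset_prod_pairs hN Y g σ]

theorem pfSum_comp_perm {N m : ℕ} (hN : N = 2 * m) (S : Fin N → Fin N → ℚ)
    (π : Equiv.Perm (Fin N)) :
    pfSum hN (fun a b => S (π a) (π b)) = ((Equiv.Perm.sign π : ℤ) : ℚ) * pfSum hN S := by
  unfold pfSum
  rw [Finset.mul_sum]
  refine Fintype.sum_equiv (Equiv.mulLeft π) _ _ fun σ => ?_
  rw [← mul_assoc]
  rcases Int.units_eq_one_or (Equiv.Perm.sign π) with h | h <;> simp [h]

theorem pfSum_comp_eq_zero {N m : ℕ} (hN : N = 2 * m) (S : Fin N → Fin N → ℚ)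
    (f : Fin N → Fin N) (hf : ¬ Function.Injective f) :
    pfSum hN (fun a b => S (f a) (f b)) = 0 := by
  simp only [Function.Injective, not_forall] at hf
  obtain ⟨i, j, hij, hne⟩ := hf
  have h := pfSum_comp_perm hN (fun a b => S (f a) (f b)) (Equiv.swap i j)
  have hs : ∀ a, f (Equiv.swap i j a) = f a := by
    intro a
    by_cases hi : a = i
    · simp [hi, hij]
    · by_cases hj : a = j
      · simp [hj, hij]
      · rw [Equiv.swap_apply_of_ne_of_ne hi hj]
  simp only [hs, Equiv.Perm.sign_swap hne] at h
  push_cast at h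
  linarith

/-- The Pfaffian of `B S Bᵀ` is `det B` times the Pfaffian of `S`. -/
theorem pfSum_congruence {N m : ℕ} (hN : N = 2 * m) (B : Matrix (Fin N) (Fin N) ℚ)
    (S : Fin N → Fin N → ℚ) :
    pfSum hN (fun a b => ∑ p, ∑ q, B a p * B b q * S p q) = B.det * pfSum hN S := by
  rw [← sum_piFinset_pfSum hN (fun _ => Finset.univ) (fun a p b q => B a p * B b q * S p q)]
  have hfactor : ∀ f : Fin N → Fin N,
      pfSum hN (fun a b => B a (f a) * B b (f b) * S (f a) (f b)) =
        (∏ a, B a (f a)) * pfSum hN (fun a b => S (f a) (f b)) := by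
    intro f
    unfold pfSum
    rw [Finset.mul_sum]
    refine Finset.sum_congr rfl fun σ _ => ?_
    rw [Finset.prod_mul_distrib, prod_pairs hN (fun a => B (σ a) (f (σ a))),
      Equiv.prod_comp σ (fun a => B a (f a))]
    ring
  simp only [hfactor, Fintype.piFinset_univ]
  rw [← Matrix.det_transpose, Matrix.det_apply', Finset.sum_mul]
  symm
  refine Finset.sum_of_injOn (fun π : Equiv.Perm (Fin N) => (π : Fin N → Fin N))
    (fun _ _ _ _ h => DFunLike.coe_injective h) (by simp) ?_ ?_
  · intro f _ hf
    rw [pfSum_comp_eq_zero hN S f, mul_zero]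
    intro hinj
    exact hf ⟨Equiv.ofBijective f (Finite.injective_iff_bijective.mp hinj), by simp, rfl⟩
  · intro π _
    rw [pfSum_comp_perm hN S π]
    simp only [Matrix.transpose_apply]
    ring

/-- The summand of `pfSum` indexed by the permutation `σ`. -/
def pfTerm {N m : ℕ} (hN : N = 2 * m) (S : Fin N → Fin N → ℚ) (σ : Equiv.Perm (Fin N)) : ℚ :=
  ((Equiv.Perm.sign σ : ℤ) : ℚ) * ∏ i : Fin m, S (σ (pairLeft hN i)) (σ (pairRight hN i))

theorem pairLeft_ne_pairRight {N m : ℕ} (hN : N = 2 * m) (i j : Fin m) :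
    pairLeft hN i ≠ pairRight hN j := by
  simp only [pairLeft, pairRight, ne_eq, Fin.ext_iff]
  omega

theorem pairLeft_injective {N m : ℕ} (hN : N = 2 * m) : Function.Injective (pairLeft hN) := by
  intro i j h
  simp only [pairLeft, Fin.ext_iff] at h ⊢
  omega

theorem pairRight_injective {N m : ℕ} (hN : N = 2 * m) : Function.Injective (pairRight hN) := by
  intro i j h
  simp only [pairRight, Fin.ext_iff] at h ⊢
  omega

theorem pfTerm_mul_swap_pair {N m : ℕ} (hN : N = 2 * m) {S : Fin N → Fin N → ℚ}
    (hS : ∀ a b, S a b = -S b a) (i : Fin m) (σ : Equiv.Perm (Fin N)) :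
    pfTerm hN S (σ * Equiv.swap (pairLeft hN i) (pairRight hN i)) = pfTerm hN S σ := by
  unfold pfTerm
  rw [← Finset.mul_prod_erase _ _ (Finset.mem_univ i),
    ← Finset.mul_prod_erase (a := i) _ (fun j => S (σ (pairLeft hN j)) (σ (pairRight hN j)))
      (Finset.mem_univ i)]
  have hrest : ∀ j ∈ Finset.univ.erase i,
      S ((σ * Equiv.swap (pairLeft hN i) (pairRight hN i)) (pairLeft hN j))
        ((σ * Equiv.swap (pairLeft hN i) (pairRight hN i)) (pairRight hN j)) =
      S (σ (pairLeft hN j)) (σ (pairRight hN j)) := by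
    intro j hj
    have hji : j ≠ i := Finset.ne_of_mem_erase hj
    rw [Equiv.Perm.mul_apply, Equiv.Perm.mul_apply,
      Equiv.swap_apply_of_ne_of_ne ((pairLeft_injective hN).ne hji) (pairLeft_ne_pairRight hN j i),
      Equiv.swap_apply_of_ne_of_ne (pairLeft_ne_pairRight hN i j).symm
        ((pairRight_injective hN).ne hji)]
  rw [Finset.prod_congr rfl hrest, Equiv.Perm.mul_apply, Equiv.Perm.mul_apply,
    Equiv.swap_apply_left, Equiv.swap_apply_right, hS, Equiv.Perm.sign_mul,
    Equiv.Perm.sign_swap (pairLeft_ne_pairRight hN i i)]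
  push_cast
  ring

theorem pfTerm_mul_swap_pairs {N m : ℕ} (hN : N = 2 * m) (S : Fin N → Fin N → ℚ)
    {i j : Fin m} (hij : i ≠ j) (σ : Equiv.Perm (Fin N)) :
    pfTerm hN S (σ * (Equiv.swap (pairLeft hN i) (pairLeft hN j) *
      Equiv.swap (pairRight hN i) (pairRight hN j))) = pfTerm hN S σ := by
  have hl : ∀ k, (Equiv.swap (pairLeft hN i) (pairLeft hN j) *
      Equiv.swap (pairRight hN i) (pairRight hN j)) (pairLeft hN k) =
        pairLeft hN (Equiv.swap i j k) := by
    intro k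
    rw [Equiv.Perm.mul_apply, Equiv.swap_apply_of_ne_of_ne (pairLeft_ne_pairRight hN k i)
      (pairLeft_ne_pairRight hN k j), (pairLeft_injective hN).swap_apply]
  have hr : ∀ k, (Equiv.swap (pairLeft hN i) (pairLeft hN j) *
      Equiv.swap (pairRight hN i) (pairRight hN j)) (pairRight hN k) =
        pairRight hN (Equiv.swap i j k) := by
    intro k
    rw [Equiv.Perm.mul_apply, (pairRight_injective hN).swap_apply,
      Equiv.swap_apply_of_ne_of_ne (pairLeft_ne_pairRight hN i _).symm
      (pairLeft_ne_pairRight hN j _).symm]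
  unfold pfTerm
  congr 1
  · rw [Equiv.Perm.sign_mul, Equiv.Perm.sign_mul,
      Equiv.Perm.sign_swap ((pairLeft_injective hN).ne hij),
      Equiv.Perm.sign_swap ((pairRight_injective hN).ne hij)]
    simp
  · refine Fintype.prod_equiv (Equiv.swap i j) _ _ fun k => ?_
    rw [Equiv.Perm.mul_apply σ, Equiv.Perm.mul_apply σ, hl, hr]

theorem exists_pfTerm_invariant {N m : ℕ} (hN : N = 2 * m) {S : Fin N → Fin N → ℚ}
    (hS : ∀ a b, S a b = -S b a) (i : Fin m) (q : Fin N) :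
    ∃ τ : Equiv.Perm (Fin N), τ (pairLeft hN i) = q ∧
      ∀ σ, pfTerm hN S (σ * τ) = pfTerm hN S σ := by
  have hleft : ∀ j, ∃ τ : Equiv.Perm (Fin N), τ (pairLeft hN i) = pairLeft hN j ∧
      ∀ σ, pfTerm hN S (σ * τ) = pfTerm hN S σ := by
    intro j
    by_cases hij : i = j
    · exact ⟨1, by simp [hij], by simp⟩
    · refine ⟨_, ?_, pfTerm_mul_swap_pairs hN S hij⟩
      rw [Equiv.Perm.mul_apply, Equiv.swap_apply_of_ne_of_ne (pairLeft_ne_pairRight hN i i)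
        (pairLeft_ne_pairRight hN i j), Equiv.swap_apply_left]
  obtain ⟨⟨j, b⟩, rfl⟩ := (pairEquiv hN).surjective q
  obtain ⟨τ, hτ, hinv⟩ := hleft j
  cases b
  · exact ⟨τ, by simpa [pairEquiv] using hτ, hinv⟩
  · refine ⟨Equiv.swap (pairLeft hN j) (pairRight hN j) * τ, ?_, fun σ => ?_⟩
    · simp [hτ, pairEquiv]
    · rw [← mul_assoc, hinv, pfTerm_mul_swap_pair hN hS]

/-- Expansion of the Pfaffian along a first row whose only nonzero entry is the second one. -/
theorem pfSum_expand {N m : ℕ} (hN : N + 2 = 2 * (m + 1)) (hN' : N = 2 * m)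
    {S : Fin (N + 2) → Fin (N + 2) → ℚ} (hS : ∀ a b, S a b = -S b a)
    (h0 : ∀ b, b ≠ 1 → S 0 b = 0) :
    pfSum hN S = 2 * (m + 1) * S 0 1 * pfSum hN' (fun a b => S a.succ.succ b.succ.succ) := by
  have hfiber : ∀ q : Fin (N + 2),
      ∑ σ : Equiv.Perm (Fin (N + 2)), (if σ q = 0 then pfTerm hN S σ else 0) =
      ∑ σ : Equiv.Perm (Fin (N + 2)), (if σ 0 = 0 then pfTerm hN S σ else 0) := by
    intro q
    obtain ⟨τ, hτ, hinv⟩ := exists_pfTerm_invariant hN hS 0 q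
    refine Fintype.sum_equiv (Equiv.mulRight τ) _ _ fun σ => ?_
    have : τ 0 = q := hτ
    simp [this, hinv]
  have hsplit : pfSum hN S = ∑ q : Fin (N + 2), ∑ σ : Equiv.Perm (Fin (N + 2)),
      (if σ q = 0 then pfTerm hN S σ else 0) := by
    rw [Finset.sum_comm]
    refine Finset.sum_congr rfl fun σ _ => ?_
    simp_rw [← Equiv.eq_symm_apply]
    simp [pfTerm]
  have hfix : ∑ σ : Equiv.Perm (Fin (N + 2)), (if σ 0 = 0 then pfTerm hN S σ else 0) =
      S 0 1 * pfSum hN' (fun a b => S a.succ.succ b.succ.succ) := by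
    rw [← Equiv.Perm.decomposeFin.symm.sum_comp, Fintype.sum_prod_type,
      Fintype.sum_eq_single 0 (fun p hp => by simp [hp]),
      ← Equiv.Perm.decomposeFin.symm.sum_comp, Fintype.sum_prod_type,
      Fintype.sum_eq_single 0]
    · rw [pfSum, Finset.mul_sum]
      refine Finset.sum_congr rfl fun σ _ => ?_
      have hl0 : pairLeft hN 0 = 0 := rfl
      have hr0 : pairRight hN 0 = Fin.succ 0 := rfl
      have hl : ∀ i : Fin m, pairLeft hN i.succ = (pairLeft hN' i).succ.succ := fun i => by
        simp [pairLeft, Fin.ext_iff]; ring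
      have hr : ∀ i : Fin m, pairRight hN i.succ = (pairRight hN' i).succ.succ := fun i => by
        simp [pairRight, Fin.ext_iff]; ring
      simp only [pfTerm, Fin.prod_univ_succ, hl0, hr0, hl, hr]
      simp
      ring
    · intro p hp
      refine Finset.sum_eq_zero fun σ _ => ?_
      have hl0 : pairLeft hN 0 = 0 := rfl
      have hr0 : pairRight hN 0 = Fin.succ 0 := rfl
      have hp1 : p.succ ≠ 1 := fun h => hp (Fin.succ_injective _ h)
      simp only [pfTerm, Fin.prod_univ_succ, hl0, hr0]
      simp [h0 _ hp1]
  rw [hsplit, Finset.sum_congr rfl fun q _ => hfiber q, Finset.sum_const, hfix]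
  simp only [Finset.card_univ, Fintype.card_fin, nsmul_eq_mul, hN]
  push_cast
  ring

/-- The Pfaffian of a skew-symmetric array `S` of order `N = 2m`. -/
def pf {N m : ℕ} (hN : N = 2 * m) (S : Fin N → Fin N → ℚ) : ℚ :=
  (2 ^ m * m.factorial : ℚ)⁻¹ * pfSum hN S

/-- Expansion of the Pfaffian along a last column whose only nonzero entry is the first one. -/
theorem pf_expand_last {N m : ℕ} (hN : N + 2 = 2 * (m + 1)) (hN' : N = 2 * m)
    {S : Fin (N + 2) → Fin (N + 2) → ℚ} (hS : ∀ a b, S a b = -S b a)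
    (hlast : ∀ a, a ≠ 0 → S a (Fin.last _) = 0) :
    pf hN S = S 0 (Fin.last _) * pf hN' (fun a b => S a.succ.castSucc b.succ.castSucc) := by
  have hrot0 : (finRotate (N + 2)).symm 0 = Fin.last _ := by
    rw [Equiv.symm_apply_eq, finRotate_last]
  have hrot : ∀ a : Fin (N + 1), (finRotate (N + 2)).symm a.succ = a.castSucc := by
    intro a
    rw [Equiv.symm_apply_eq, finRotate_apply, Fin.coeSucc_eq_succ]
  have hsign : (Equiv.Perm.sign (finRotate (N + 2)).symm : ℤ) = -1 := by
    rw [Equiv.Perm.sign_symm, sign_finRotate, hN']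
    simp [pow_succ, pow_mul]
  have hperm := pfSum_comp_perm hN S (finRotate (N + 2)).symm
  rw [hsign, pfSum_expand hN hN' (fun a b => hS _ _)] at hperm
  · have h1 : (1 : Fin (N + 2)) = Fin.succ 0 := rfl
    simp only [hrot0, h1, hrot, Fin.castSucc_zero, ← Fin.succ_castSucc] at hperm
    have hS' := hS (Fin.last (N + 1)) 0
    rw [hS'] at hperm
    push_cast at hperm
    unfold pf
    have hP : pfSum hN S = 2 * (m + 1) * S 0 (Fin.last (N + 1)) *
      pfSum hN' (fun a b => S a.succ.castSucc b.succ.castSucc) := by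
      simp only [← Fin.succ_castSucc]
      linarith
    rw [hP, Nat.factorial_succ]
    have : (m.factorial : ℚ) ≠ 0 := by exact_mod_cast m.factorial_ne_zero
    push_cast
    field_simp
    ring
  · intro b hb
    rw [hrot0, hS, hlast, neg_zero]
    intro h
    rw [Equiv.symm_apply_eq] at h
    exact hb (by rw [h, finRotate_apply]; rfl)

/-- Adding to each row (and column) a combination of earlier ones preserves the Pfaffian. -/
theorem pf_unitriangular {N m : ℕ} (hN : N = 2 * m) (B : Matrix (Fin N) (Fin N) ℚ)
    (hB : ∀ i j, i < j → B i j = 0) (hB1 : ∀ i, B i i = 1) (S : Fin N → Fin N → ℚ) :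
    pf hN (fun a b => ∑ p, ∑ q, B a p * B b q * S p q) = pf hN S := by
  rw [pf, pfSum_congruence, Matrix.det_of_isLowerTriangular B (fun i j h => hB i j h)]
  simp [hB1, pf]

theorem qbinom_zero (x : ℚ) : qbinom x 0 = 1 := by simp [qbinom]

theorem qbinom_succ_sub (x : ℚ) (m : ℕ) :
    qbinom (x + 1) (m + 1) - qbinom x (m + 1) = qbinom x m := by
  have h1 : ∏ j ∈ Finset.range (m + 1), (x + 1 - (j : ℚ)) =
      (∏ j ∈ Finset.range m, (x - j)) * (x + 1) := by
    rw [Finset.prod_range_succ']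
    simp
  have h2 : (m.factorial : ℚ) ≠ 0 := by exact_mod_cast m.factorial_ne_zero
  have h3 : (m + 1 : ℚ) ≠ 0 := by positivity
  rw [qbinom, qbinom, qbinom, h1, Finset.prod_range_succ, Nat.factorial_succ]
  push_cast
  field_simp
  ring

theorem qbinom_natCast_succ (m : ℕ) : qbinom m (m + 1) = 0 := by
  rw [qbinom, Finset.prod_range_succ, sub_self, mul_zero, zero_div]

theorem qbinom_natCast_self (m : ℕ) : qbinom m m = 1 := by
  induction m with
  | zero => exact qbinom_zero _
  | succ m ih =>
    have h := qbinom_succ_sub m m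
    rw [qbinom_natCast_succ, ih, sub_zero] at h
    exact_mod_cast h

theorem Polynomial.eq_zero_of_eval_intCast (p : Polynomial ℚ) (c : ℤ)
    (hp : ∀ x : ℤ, c ≤ x → p.eval (x : ℚ) = 0) : p = 0 := by
  refine Polynomial.eq_zero_of_infinite_isRoot p ?_
  refine Set.Infinite.mono ?_ ((Set.Ici_infinite c).image (Int.cast_injective (α := ℚ)).injOn)
  rintro _ ⟨x, hx, rfl⟩
  exact hp x hx

theorem eval_aeval_pair (P : MvPolynomial (Fin 2) ℚ) (u v : Polynomial ℚ) (x : ℚ) :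
    (MvPolynomial.aeval ![u, v] P).eval x = MvPolynomial.eval ![u.eval x, v.eval x] P := by
  have h := MvPolynomial.comp_aeval_apply (R := ℚ) (f := ![u, v]) (Polynomial.aeval x) P
  rw [Polynomial.coe_aeval_eq_eval] at h
  have hv : (fun i => Polynomial.eval x (![u, v] i)) = ![u.eval x, v.eval x] := by
    funext i
    fin_cases i <;> rfl
  rw [h, hv]
  rfl

/-- The values of `gt_h` at integer points. -/
def gtValue (gt : ℕ → MvPolynomial (Fin 2) ℚ) (h : ℕ) (x y : ℤ) : ℚ :=
  MvPolynomial.eval ![(x : ℚ), (y : ℚ)] (gt h)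

/-- The summand in the definition of `gt_h`. -/
def gtSummand (h : ℕ) (x y p : ℤ) : ℚ :=
  qbinom ((x : ℚ) - (p : ℚ) + (h : ℚ) - 1) h * qbinom ((y : ℚ) - (p : ℚ) + (h : ℚ) - 2) h -
    qbinom ((x : ℚ) - (p : ℚ) + (h : ℚ) - 2) h * qbinom ((y : ℚ) - (p : ℚ) + (h : ℚ) - 1) h

theorem gtValue_zero {gt : ℕ → MvPolynomial (Fin 2) ℚ} (hgt : gtChar gt) (x y : ℤ) :
    gtValue gt 0 x y = 1 := by
  simp [gtValue, hgt.1]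

theorem gtValue_succ_of_le {gt : ℕ → MvPolynomial (Fin 2) ℚ} (hgt : gtChar gt) (h : ℕ)
    {x : ℤ} (hx : (h : ℤ) + 1 ≤ x) (y : ℤ) :
    gtValue gt (h + 1) x y = ∑ p ∈ Finset.Icc ((h : ℤ) + 1) (x - 1), gtSummand (h + 1) x y p := by
  exact hgt.2 (h + 1) (by omega) x y (by exact_mod_cast hx)

theorem gtValue_succ_self {gt : ℕ → MvPolynomial (Fin 2) ℚ} (hgt : gtChar gt) (h : ℕ) (x : ℤ) :
    gtValue gt (h + 1) x x = 0 := by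
  have hp : MvPolynomial.aeval ![Polynomial.X, Polynomial.X] (gt (h + 1)) = (0 : Polynomial ℚ) := by
    refine Polynomial.eq_zero_of_eval_intCast _ (h + 1) fun x hx => ?_
    rw [eval_aeval_pair, Polynomial.eval_X]
    refine (gtValue_succ_of_le hgt h hx x).trans (Finset.sum_eq_zero fun p _ => ?_)
    rw [gtSummand]
    ring
  have h := eval_aeval_pair (gt (h + 1)) Polynomial.X Polynomial.X x
  rw [hp, Polynomial.eval_zero, Polynomial.eval_X] at h
  exact h.symm

theorem gtSummand_mixed_difference (h : ℕ) (x y p : ℤ) :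
    gtSummand (h + 1) (x + 1) (y + 1) p - gtSummand (h + 1) x (y + 1) p -
      gtSummand (h + 1) (x + 1) y p + gtSummand (h + 1) x y p = gtSummand h x y (p - 1) := by
  have hx1 := qbinom_succ_sub ((x : ℚ) - p + h) h
  have hx2 := qbinom_succ_sub ((x : ℚ) - p + h - 1) h
  have hy1 := qbinom_succ_sub ((y : ℚ) - p + h) h
  have hy2 := qbinom_succ_sub ((y : ℚ) - p + h - 1) h
  simp only [gtSummand]
  push_cast
  ring_nf at hx1 hx2 hy1 hy2 ⊢
  rw [← hx1, ← hx2, ← hy1, ← hy2]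
  ring

theorem gtSummand_boundary_difference (h : ℕ) (x y : ℤ) :
    gtSummand (h + 1) (x + 1) (y + 1) x - gtSummand (h + 1) (x + 1) y x =
      qbinom ((y : ℚ) - x + h - 1) h := by
  have h1 := qbinom_succ_sub ((y : ℚ) - x + h - 1) h
  have h2 := qbinom_natCast_self (h + 1)
  have h3 := qbinom_natCast_succ h
  simp only [gtSummand]
  push_cast at h2 ⊢
  have e1 : ((x : ℚ) + 1 - x + (h + 1) - 1) = h + 1 := by ring
  have e2 : ((x : ℚ) + 1 - x + (h + 1) - 2) = h := by ring
  rw [e1, e2, h2, h3, ← h1]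
  ring_nf

theorem gtSummand_succ_last (h : ℕ) (x y : ℤ) :
    gtSummand (h + 1) x y (x - 1) = qbinom ((y : ℚ) - x + h) (h + 1) := by
  have h2 := qbinom_natCast_self (h + 1)
  have h3 := qbinom_natCast_succ h
  simp only [gtSummand]
  push_cast at h2 ⊢
  have e1 : ((x : ℚ) - (x - 1) + (h + 1) - 1) = h + 1 := by ring
  have e2 : ((x : ℚ) - (x - 1) + (h + 1) - 2) = h := by ring
  rw [e1, e2, h2, h3]
  ring_nf

theorem sum_Icc_succ_right (f : ℤ → ℚ) {p q : ℤ} (hpq : p ≤ q + 1) :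
    ∑ s ∈ Finset.Icc p (q + 1), f s = ∑ s ∈ Finset.Icc p q, f s + f (q + 1) := by
  have : Finset.Icc p (q + 1) = insert (q + 1) (Finset.Icc p q) := by
    ext s
    simp only [Finset.mem_Icc, Finset.mem_insert]
    omega
  rw [this, Finset.sum_insert (by simp), add_comm]

theorem sum_Icc_sub_one (f : ℤ → ℚ) (p q : ℤ) :
    ∑ s ∈ Finset.Icc (p + 1) (q + 1), f (s - 1) = ∑ s ∈ Finset.Icc p q, f s := by
  refine Finset.sum_nbij' (fun s => s - 1) (fun s => s + 1) ?_ ?_ ?_ ?_ (fun _ _ => rfl) <;>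
    simp only [Finset.mem_Icc] <;> intros <;> omega

theorem gtValue_mixed_difference_of_le {gt : ℕ → MvPolynomial (Fin 2) ℚ} (hgt : gtChar gt) (h : ℕ)
    {x : ℤ} (hx : (h : ℤ) + 1 ≤ x) (y : ℤ) :
    gtValue gt (h + 1) (x + 1) (y + 1) - gtValue gt (h + 1) x (y + 1) -
      gtValue gt (h + 1) (x + 1) y + gtValue gt (h + 1) x y = gtValue gt h x y := by
  have hx' : (h : ℤ) + 1 ≤ x + 1 := by omega
  have hlast : ∀ f : ℤ → ℚ, ∑ p ∈ Finset.Icc ((h : ℤ) + 1) x, f p =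
      ∑ p ∈ Finset.Icc ((h : ℤ) + 1) (x - 1), f p + f x := by
    intro f
    simpa using sum_Icc_succ_right f (p := (h : ℤ) + 1) (q := x - 1) (by omega)
  rw [gtValue_succ_of_le hgt h hx', gtValue_succ_of_le hgt h hx', gtValue_succ_of_le hgt h hx,
    gtValue_succ_of_le hgt h hx, add_sub_cancel_right, hlast, hlast]
  have hsum : ∑ p ∈ Finset.Icc ((h : ℤ) + 1) (x - 1), gtSummand h x y (p - 1) =
      ∑ p ∈ Finset.Icc ((h : ℤ) + 1) (x - 1), gtSummand (h + 1) (x + 1) (y + 1) p -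
      ∑ p ∈ Finset.Icc ((h : ℤ) + 1) (x - 1), gtSummand (h + 1) x (y + 1) p -
      ∑ p ∈ Finset.Icc ((h : ℤ) + 1) (x - 1), gtSummand (h + 1) (x + 1) y p +
      ∑ p ∈ Finset.Icc ((h : ℤ) + 1) (x - 1), gtSummand (h + 1) x y p := by
    simp only [← Finset.sum_sub_distrib, ← Finset.sum_add_distrib, gtSummand_mixed_difference]
  have hb := gtSummand_boundary_difference h x y
  have hshift := sum_Icc_sub_one (fun p => gtSummand h x y p) h (x - 2)
  rw [show x - 2 + 1 = x - 1 by ring] at hshift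
  rw [hshift] at hsum
  have hgoal : ∑ p ∈ Finset.Icc (h : ℤ) (x - 2), gtSummand h x y p +
      qbinom ((y : ℚ) - x + h - 1) h = gtValue gt h x y := by
    cases h with
    | zero => simp [gtSummand, qbinom_zero, gtValue_zero hgt]
    | succ h =>
      rw [gtValue_succ_of_le hgt h (by push_cast at hx; omega)]
      have hs := sum_Icc_succ_right (fun p => gtSummand (h + 1) x y p)
        (p := (h : ℤ) + 1) (q := x - 2) (by push_cast at hx; omega)
      rw [show x - 2 + 1 = x - 1 by ring] at hs
      rw [hs, gtSummand_succ_last]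
      push_cast
      ring_nf
  linarith

theorem gtValue_mixed_difference {gt : ℕ → MvPolynomial (Fin 2) ℚ} (hgt : gtChar gt) (h : ℕ)
    (x y : ℤ) :
    gtValue gt (h + 1) (x + 1) (y + 1) - gtValue gt (h + 1) x (y + 1) -
      gtValue gt (h + 1) (x + 1) y + gtValue gt (h + 1) x y = gtValue gt h x y := by
  let X : Polynomial ℚ := Polynomial.X
  let D : Polynomial ℚ :=
    MvPolynomial.aeval ![X + 1, Polynomial.C ((y : ℚ) + 1)] (gt (h + 1)) -
    MvPolynomial.aeval ![X, Polynomial.C ((y : ℚ) + 1)] (gt (h + 1)) -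
    MvPolynomial.aeval ![X + 1, Polynomial.C (y : ℚ)] (gt (h + 1)) +
    MvPolynomial.aeval ![X, Polynomial.C (y : ℚ)] (gt (h + 1)) -
    MvPolynomial.aeval ![X, Polynomial.C (y : ℚ)] (gt h)
  have hD : ∀ x : ℤ, D.eval (x : ℚ) =
      gtValue gt (h + 1) (x + 1) (y + 1) - gtValue gt (h + 1) x (y + 1) -
      gtValue gt (h + 1) (x + 1) y + gtValue gt (h + 1) x y - gtValue gt h x y := by
    intro x
    simp only [D, X, Polynomial.eval_sub, Polynomial.eval_add, eval_aeval_pair, gtValue,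
      Polynomial.eval_X, Polynomial.eval_C, Polynomial.eval_one, Int.cast_add, Int.cast_one]
  have hzero : D = 0 := by
    refine Polynomial.eq_zero_of_eval_intCast D (h + 1) fun x hx => ?_
    rw [hD, gtValue_mixed_difference_of_le hgt h hx, sub_self]
  have := hD x
  rw [hzero, Polynomial.eval_zero] at this
  linarith

theorem sum_Icc_difference (u : ℤ → ℚ) (c : ℤ) {p q : ℤ} (hpq : p ≤ q) :
    ∑ s ∈ Finset.Icc p q, (u (s + c + 1) - u (s + c)) = u (q + c + 1) - u (p + c) := by
  induction q, hpq using Int.leInduction with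
  | base => simp
  | succ q hq ih =>
    rw [sum_Icc_succ_right _ (by omega), ih, show q + 1 + c = q + c + 1 by ring]
    ring

/-- The trapezoids with bottom row `k`. -/
abbrev GTSet (h n : ℕ) (k : Fin n → ℤ) : Type :=
  {a : GTIdx h n → ℤ //
    IsGT h n a ∧ ∀ i : Fin n, a (mkIdx h n h i.val le_rfl (by have := i.isLt; omega)) = k i}

/-- The rows interlacing with `k`. -/
def interlacing {n : ℕ} (k : Fin (n + 1) → ℤ) : Finset (Fin n → ℤ) :=
  Fintype.piFinset fun i => Finset.Icc (k i.castSucc) (k i.succ)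

/-- Append the row `k` at the bottom of a trapezoid. -/
def appendRow {h n : ℕ} (hhn : h ≤ n) (k : Fin (n + 1) → ℤ) (b : GTIdx h n → ℤ) :
    GTIdx (h + 1) (n + 1) → ℤ := fun p =>
  if hr : p.1.1 ≤ h then b (mkIdx h n p.1.1 p.1.2 hr (by have := p.2.2; omega))
  else k ⟨p.1.2, by have := p.2; omega⟩

theorem appendRow_of_le {h n : ℕ} (hhn : h ≤ n) (k : Fin (n + 1) → ℤ) (b : GTIdx h n → ℤ)
    (r c : ℕ) (hr : r ≤ h) (hc : c < n - h + r) (hr' : r ≤ h + 1)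
    (hc' : c < n + 1 - (h + 1) + r) :
    appendRow hhn k b (mkIdx (h + 1) (n + 1) r c hr' hc') = b (mkIdx h n r c hr hc) := by
  simp [appendRow, mkIdx, hr]

theorem appendRow_bottom {h n : ℕ} (hhn : h ≤ n) (k : Fin (n + 1) → ℤ) (b : GTIdx h n → ℤ)
    (c : ℕ) (hr : h + 1 ≤ h + 1) (hc : c < n + 1 - (h + 1) + (h + 1)) :
    appendRow hhn k b (mkIdx (h + 1) (n + 1) (h + 1) c hr hc) = k ⟨c, by omega⟩ := by
  simp [appendRow, mkIdx]

theorem isGT_appendRow {h n : ℕ} (hhn : h ≤ n) {k : Fin (n + 1) → ℤ} {l : Fin n → ℤ}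
    (hl : l ∈ interlacing k) (b : GTSet h n l) : IsGT (h + 1) (n + 1) (appendRow hhn k b.1) := by
  intro r c hr hc
  rw [appendRow_of_le hhn k b.1 r c (by omega) (by omega)]
  by_cases hrh : r = h
  · subst hrh
    rw [appendRow_bottom, appendRow_bottom]
    have hb := b.2.2 ⟨c, by omega⟩
    simp only [interlacing, Fintype.mem_piFinset, Finset.mem_Icc] at hl
    have := hl ⟨c, by omega⟩
    simp only at hb
    rw [hb]
    exact this
  · rw [appendRow_of_le hhn k b.1 (r + 1) c (by omega) (by omega),
      appendRow_of_le hhn k b.1 (r + 1) (c + 1) (by omega) (by omega)]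
    exact b.2.1 r c (by omega) (by omega)

/-- A trapezoid is a shorter trapezoid with a bottom row appended. -/
def gtSetSuccEquiv {h n : ℕ} (hhn : h ≤ n) (k : Fin (n + 1) → ℤ) :
    (Σ l : interlacing k, GTSet h n l.1) ≃ GTSet (h + 1) (n + 1) k := by
  refine Equiv.ofBijective (fun q => ⟨appendRow hhn k q.2.1, isGT_appendRow hhn q.1.2 q.2,
    fun i => appendRow_bottom hhn k _ i.1 _ _⟩) ⟨?_, ?_⟩
  · rintro ⟨⟨l, hl⟩, ⟨b, hb, hbl⟩⟩ ⟨⟨l', hl'⟩, ⟨b', hb', hbl'⟩⟩ heq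
    have hbb : b = b' := by
      funext p
      have h1 := congrFun (Subtype.ext_iff.mp heq)
        (mkIdx (h + 1) (n + 1) p.1.1 p.1.2 (by have := p.2.1; omega) (by have := p.2.2; omega))
      simp only [appendRow_of_le hhn k _ p.1.1 p.1.2 p.2.1 p.2.2] at h1
      exact h1
    subst hbb
    obtain rfl : l = l' := funext fun i => (hbl i).symm.trans (hbl' i)
    rfl
  · rintro ⟨a, ha, hak⟩
    refine ⟨⟨⟨fun i => a (mkIdx (h + 1) (n + 1) h i.1 (by omega) (by have := i.2; omega)), ?_⟩,
      ⟨fun p => a (mkIdx (h + 1) (n + 1) p.1.1 p.1.2 (by have := p.2.1; omega)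
        (by have := p.2.2; omega)), ?_, ?_⟩⟩, ?_⟩
    · simp only [interlacing, Fintype.mem_piFinset, Finset.mem_Icc]
      intro i
      rw [← hak, ← hak]
      exact ha h i.1 (by omega) (by have := i.2; omega)
    · intro r c hr hc
      exact ha r c (by omega) (by omega)
    · intro i
      rfl
    · refine Subtype.ext (funext fun p => ?_)
      obtain ⟨⟨r, c⟩, hr, hc⟩ := p
      simp only at hr hc
      by_cases hrh : r ≤ h
      · exact appendRow_of_le hhn k _ r c hrh (by omega) hr hc
      · obtain rfl : r = h + 1 := by omega
        exact (appendRow_bottom hhn k _ c hr hc).trans (hak ⟨c, by omega⟩).symm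

instance gtSetZeroUnique (n : ℕ) (k : Fin n → ℤ) : Unique (GTSet 0 n k) where
  default := ⟨fun p => k ⟨p.1.2, by have := p.2; omega⟩, fun r c hr => by omega, fun i => rfl⟩
  uniq := by
    rintro ⟨a, ha, hak⟩
    refine Subtype.ext (funext fun p => ?_)
    obtain ⟨⟨r, c⟩, hr, hc⟩ := p
    simp only at hr hc
    obtain rfl : r = 0 := by omega
    exact hak ⟨c, by omega⟩

theorem gtSet_finite {h n : ℕ} (hhn : h ≤ n) (k : Fin n → ℤ) : Finite (GTSet h n k) := by
  induction h generalizing n with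
  | zero => infer_instance
  | succ h ih =>
    obtain ⟨n, rfl⟩ : ∃ n', n = n' + 1 := ⟨n - 1, by omega⟩
    have : ∀ l : interlacing k, Finite (GTSet h n l.1) := fun l => ih (by omega) l.1
    exact Finite.of_equiv _ (gtSetSuccEquiv (by omega) k)

theorem GTcount_zero (n : ℕ) (k : Fin n → ℤ) : GTcount 0 n k = 1 :=
  Nat.card_unique (α := GTSet 0 n k)

theorem GTcount_succ {h n : ℕ} (hhn : h ≤ n) (k : Fin (n + 1) → ℤ) :
    GTcount (h + 1) (n + 1) k = ∑ l ∈ interlacing k, GTcount h n l := by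
  have : ∀ l : interlacing k, Finite (GTSet h n l.1) := fun l => gtSet_finite hhn l.1
  rw [← Finset.sum_coe_sort]
  exact (Nat.card_congr (gtSetSuccEquiv hhn k)).symm.trans Nat.card_sigma

theorem skew_ext {N : ℕ} {S T : Fin N → Fin N → ℚ} (hS : ∀ a b, S a b = -S b a)
    (hT : ∀ a b, T a b = -T b a) (h : ∀ a b, a < b → S a b = T a b) : S = T := by
  funext a b
  rcases lt_trichotomy a b with hab | rfl | hab
  · exact h a b hab
  · linarith [hS a a, hT a a]
  · rw [hS, hT, h b a hab]

/-- The entry in row `a` and column `b` of the array whose Pfaffian counts trapezoids, where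
`s` and `t` are the `a`-th and `b`-th entries of the bottom row. -/
def gtEntry (gt : ℕ → MvPolynomial (Fin 2) ℚ) (h n : ℕ) (a : ℕ) (s : ℤ) (b : ℕ) (t : ℤ) : ℚ :=
  if a < n then
    if b < n then gtValue gt h (s + (a + 1 : ℤ)) (t + (b + 1 : ℤ))
    else qbinom ((s + (a + 1 : ℤ) : ℤ) : ℚ) (h - 1 - (b - n))
  else 0

/-- The skew-symmetric extension of `gtEntry`. -/
def gtSkewEntry (gt : ℕ → MvPolynomial (Fin 2) ℚ) (h n : ℕ) (a : ℕ) (s : ℤ) (b : ℕ) (t : ℤ) : ℚ :=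
  if a < b then gtEntry gt h n a s b t else if b < a then -gtEntry gt h n b t a s else 0

theorem gtSkewEntry_skew (gt : ℕ → MvPolynomial (Fin 2) ℚ) (h n a : ℕ) (s : ℤ) (b : ℕ) (t : ℤ) :
    gtSkewEntry gt h n a s b t = -gtSkewEntry gt h n b t a s := by
  unfold gtSkewEntry
  split_ifs <;> first | omega | simp

/-- The skew-symmetric array of order `n + h` attached to the bottom row `k`. -/
def gtMatrix (gt : ℕ → MvPolynomial (Fin 2) ℚ) (h n : ℕ) (k : ℕ → ℤ) (a b : ℕ) : ℚ :=
  gtSkewEntry gt h n a (k a) b (k b)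

theorem gtMatrix_of_lt (gt : ℕ → MvPolynomial (Fin 2) ℚ) (h n : ℕ) (k : ℕ → ℤ) {a b : ℕ}
    (hab : a < b) : gtMatrix gt h n k a b = gtEntry gt h n a (k a) b (k b) := if_pos hab

/-- Extension by zero of a function on `Fin n`. -/
def extendZero {n : ℕ} (k : Fin n → ℤ) (i : ℕ) : ℤ := if hi : i < n then k ⟨i, hi⟩ else 0

theorem extendZero_coe {n : ℕ} (k : Fin n → ℤ) (i : Fin n) : extendZero k i = k i := by
  simp [extendZero]

/-- The matrix subtracting row `r i` from row `i` for all `i` satisfying `c`. -/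
def differenceMatrix (N : ℕ) (c : ℕ → Prop) [DecidablePred c] (r : ℕ → ℕ) :
    Matrix (Fin N) (Fin N) ℚ := fun i j =>
  (if i = j then 1 else 0) - if c i ∧ j.val = r i then 1 else 0

theorem sum_differenceMatrix {N : ℕ} {c : ℕ → Prop} [DecidablePred c] {r : ℕ → ℕ}
    (hr : ∀ i, c i → r i < i) (i : Fin N) (u : ℕ → ℚ) :
    ∑ j, differenceMatrix N c r i j * u j = u i - if c i then u (r i) else 0 := by
  simp only [differenceMatrix, sub_mul, ite_mul, one_mul, zero_mul, Finset.sum_sub_distrib,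
    Finset.sum_ite_eq, Finset.mem_univ, if_true]
  congr 1
  split_ifs with h
  · have := hr i h
    rw [Fintype.sum_eq_single ⟨r i, by omega⟩]
    · simp [h]
    · intro j hj
      exact if_neg fun h' => hj (Fin.ext h'.2)
  · simp [h]

theorem sum_sum_differenceMatrix {N : ℕ} {c : ℕ → Prop} [DecidablePred c] {r : ℕ → ℕ}
    (hr : ∀ i, c i → r i < i) (i j : Fin N) (S : ℕ → ℕ → ℚ) :
    ∑ p, ∑ q, differenceMatrix N c r i p * differenceMatrix N c r j q * S p q =
      (S i j - if c j then S i (r j) else 0) -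
        if c i then (S (r i) j - if c j then S (r i) (r j) else 0) else 0 := by
  simp_rw [mul_assoc, ← Finset.mul_sum, sum_differenceMatrix hr j]
  exact sum_differenceMatrix hr i fun p => S p j - if c j then S p (r j) else 0

/-- If subtracting row `r i` from row `i` clears the last column except for a top entry `1`,
then the Pfaffian is that of the inner part of the resulting array. -/
theorem pf_of_differences {N m : ℕ} (hN : N = 2 * m) (hN' : N + 2 = 2 * (m + 1))
    (c : ℕ → Prop) [DecidablePred c] (r : ℕ → ℕ) (hr : ∀ i, c i → r i < i) {S : ℕ → ℕ → ℚ}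
    (hS : ∀ a b, S a b = -S b a) (hcl : ¬ c (N + 1)) (hfirst : S 0 (N + 1) = 1)
    (hlast : ∀ a, a ≠ 0 → a ≤ N + 1 → S a (N + 1) - (if c a then S (r a) (N + 1) else 0) = 0) :
    pf hN' (fun a b => S a b) = pf hN (fun a b =>
      (S (a + 1) (b + 1) - if c (b + 1) then S (a + 1) (r (b + 1)) else 0) -
        if c (a + 1) then
          (S (r (a + 1)) (b + 1) - if c (b + 1) then S (r (a + 1)) (r (b + 1)) else 0) else 0) := by
  have hc0 : ¬ c 0 := fun h => by have := hr 0 h; omega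
  rw [← pf_unitriangular hN' (differenceMatrix (N + 2) c r) _ _ (fun a b => S a b)]
  · simp only [sum_sum_differenceMatrix hr]
    rw [pf_expand_last hN' hN]
    · simp [hc0, hcl, hfirst]
    · intro a b
      rw [hS a b, hS a (r b), hS (r a) b, hS (r a) (r b)]
      split_ifs <;> ring
    · intro a ha
      simpa [hcl] using hlast a (fun h0 => ha (Fin.ext h0)) (by omega)
  · intro i j hij
    have h1 : i ≠ j := hij.ne
    have h2 : ¬ (c i ∧ j.val = r i) := fun h => by
      have := hr i h.1
      have : i.val < j.val := hij
      omega
    simp [differenceMatrix, h1, h2]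
  · intro i
    have h2 : ¬ (c i ∧ i.val = r i) := fun h => by
      have := hr i h.1
      omega
    simp [differenceMatrix, h2]

/-- The Pfaffian of the upper triangular array with all entries `1`. -/
theorem pf_one {N m : ℕ} (hN : N = 2 * m) :
    pf hN (fun a b => if a < b then 1 else if b < a then -1 else 0) = 1 := by
  induction m generalizing N with
  | zero =>
    subst hN
    simp [pf, pfSum]
  | succ m ih =>
    obtain ⟨N, rfl⟩ : ∃ M, N = M + 2 := ⟨N - 2, by omega⟩
    have hN' : N = 2 * m := by omega
    have h := pf_of_differences hN' hN (fun i => 0 < i ∧ i < N + 1) (fun _ => 0) (fun i hi => hi.1)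
      (S := fun a b => if a < b then 1 else if b < a then -1 else 0) ?_ ?_ ?_ ?_
    · refine h.trans ((congrArg (pf hN') ?_).trans (ih hN'))
      funext a b
      have ha := a.isLt
      have hb := b.isLt
      simp [ha, hb]
    · intro a b
      split_ifs <;> first | omega | simp
    · omega
    · simp
    · intro a ha haN
      split_ifs <;> first | omega | simp

theorem sum_sum_gtValue {gt : ℕ → MvPolynomial (Fin 2) ℚ} (hgt : gtChar gt) (h : ℕ)
    (c d : ℤ) {p q p' q' : ℤ} (hpq : p ≤ q) (hpq' : p' ≤ q') :
    ∑ s ∈ Finset.Icc p q, ∑ t ∈ Finset.Icc p' q', gtValue gt h (s + c) (t + d) =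
      gtValue gt (h + 1) (q + c + 1) (q' + d + 1) - gtValue gt (h + 1) (q + c + 1) (p' + d) -
        (gtValue gt (h + 1) (p + c) (q' + d + 1) - gtValue gt (h + 1) (p + c) (p' + d)) := by
  have hinner : ∀ s, ∑ t ∈ Finset.Icc p' q', gtValue gt h (s + c) (t + d) =
      (fun x => gtValue gt (h + 1) x (q' + d + 1) - gtValue gt (h + 1) x (p' + d)) (s + c + 1) -
      (fun x => gtValue gt (h + 1) x (q' + d + 1) - gtValue gt (h + 1) x (p' + d)) (s + c) := by
    intro s
    have := sum_Icc_difference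
      (fun y => gtValue gt (h + 1) (s + c + 1) y - gtValue gt (h + 1) (s + c) y) d hpq'
    simp only at this ⊢
    rw [sub_sub_sub_comm, ← this]
    refine Finset.sum_congr rfl fun t _ => ?_
    rw [← gtValue_mixed_difference hgt]
    ring
  simp_rw [hinner]
  exact sum_Icc_difference
    (fun x => gtValue gt (h + 1) x (q' + d + 1) - gtValue gt (h + 1) x (p' + d)) c hpq

theorem sum_qbinom (j : ℕ) (c : ℤ) {p q : ℤ} (hpq : p ≤ q) :
    ∑ s ∈ Finset.Icc p q, qbinom ((s + c : ℤ) : ℚ) j =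
      qbinom ((q + c + 1 : ℤ) : ℚ) (j + 1) - qbinom ((p + c : ℤ) : ℚ) (j + 1) := by
  rw [← sum_Icc_difference (fun x => qbinom (x : ℚ) (j + 1)) c hpq]
  refine Finset.sum_congr rfl fun s _ => ?_
  rw [← qbinom_succ_sub]
  push_cast
  rfl

/-- The range of the `a`-th entry of a row interlacing with `k`, and `{0}` beyond that row. -/
def entryRange (n : ℕ) (k : ℕ → ℤ) (a : ℕ) : Finset ℤ :=
  if a < n then Finset.Icc (k a) (k (a + 1)) else {0}

/-- Summation over interlacing rows turns the array for `(h, n)` into the difference array of the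
one for `(h + 1, n + 1)`. -/
theorem sum_gtEntry {gt : ℕ → MvPolynomial (Fin 2) ℚ} (hgt : gtChar gt) {h n : ℕ} {k : ℕ → ℤ}
    (hk : ∀ i < n, k i ≤ k (i + 1)) {a b : ℕ} (hab : a < b) (hb : b < n + h) :
    ∑ s ∈ entryRange n k a, ∑ t ∈ entryRange n k b, gtEntry gt h n a s b t =
      (gtMatrix gt (h + 1) (n + 1) k (a + 1) (b + 1) -
        if b < n then gtMatrix gt (h + 1) (n + 1) k (a + 1) b else 0) -
      if a < n then gtMatrix gt (h + 1) (n + 1) k a (b + 1) -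
        if b < n then gtMatrix gt (h + 1) (n + 1) k a b else 0
      else 0 := by
  by_cases hbn : b < n
  · have ha : a < n := by omega
    rw [if_pos hbn, if_pos ha, if_pos hbn]
    simp only [entryRange, gtEntry, ha, hbn, if_true]
    rw [sum_sum_gtValue hgt h _ _ (hk _ ha) (hk _ hbn)]
    have hmid : gtMatrix gt (h + 1) (n + 1) k (a + 1) b =
        gtValue gt (h + 1) (k (a + 1) + (a + 1) + 1) (k b + (b + 1)) := by
      rcases Nat.lt_or_ge (a + 1) b with hlt | hge
      · rw [gtMatrix_of_lt _ _ _ _ hlt, gtEntry, if_pos (by omega), if_pos (by omega)]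
        push_cast
        congr 1
        ring
      · have heq : b = a + 1 := by omega
        have : k (a + 1) + ((a : ℤ) + 1) + 1 = k (a + 1) + (((a + 1 : ℕ) : ℤ) + 1) := by
          push_cast; ring
        rw [heq, this, gtValue_succ_self hgt]
        simp [gtMatrix, gtSkewEntry]
    rw [hmid, gtMatrix_of_lt _ _ _ _ (by omega), gtMatrix_of_lt _ _ _ _ (by omega),
      gtMatrix_of_lt _ _ _ _ (by omega)]
    simp only [gtEntry]
    rw [if_pos (by omega), if_pos (by omega), if_pos (by omega), if_pos (by omega),
      if_pos (by omega), if_pos (by omega)]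
    push_cast
    simp only [add_assoc]
  · rw [if_neg hbn, sub_zero, gtMatrix_of_lt _ _ _ _ (by omega)]
    by_cases ha : a < n
    · rw [if_pos ha, if_neg hbn, sub_zero, gtMatrix_of_lt _ _ _ _ (by omega)]
      simp only [entryRange, gtEntry, ha, hbn, if_true, if_false, Finset.sum_singleton]
      rw [sum_qbinom _ _ (hk _ ha), if_pos (by omega), if_neg (by omega), if_pos (by omega),
        if_neg (by omega)]
      have he : h + 1 - 1 - (b + 1 - (n + 1)) = h - 1 - (b - n) + 1 := by omega
      rw [he]
      push_cast
      simp only [add_assoc]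
    · rw [if_neg ha]
      simp only [gtEntry, ha, if_false, Finset.sum_const_zero]
      rw [if_neg (by omega), sub_zero]

theorem sum_interlacing_pf (gt : ℕ → MvPolynomial (Fin 2) ℚ) {h n m : ℕ} (hN : n + h = 2 * m)
    (k : Fin (n + 1) → ℤ) :
    ∑ l ∈ interlacing k, pf hN (fun a b => gtMatrix gt h n (extendZero l) a b) =
      pf hN (fun a b => ∑ s ∈ entryRange n (extendZero k) a,
        ∑ t ∈ entryRange n (extendZero k) b, gtSkewEntry gt h n a s b t) := by
  simp only [pf, ← Finset.mul_sum]
  congr 1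
  rw [← sum_piFinset_pfSum hN (fun a => entryRange n (extendZero k) a)
    (fun a s b t => gtSkewEntry gt h n a s b t)]
  have hrange : ∀ i : Fin n, entryRange n (extendZero k) i =
      Finset.Icc (k i.castSucc) (k i.succ) := by
    intro i
    rw [entryRange, if_pos i.isLt]
    exact congrArg₂ _ (extendZero_coe k i.castSucc) (extendZero_coe k i.succ)
  refine Finset.sum_nbij' (fun l a => extendZero l a) (fun f i => f (Fin.castAdd h i))
    ?_ ?_ ?_ ?_ (fun l _ => rfl)
  · intro l hl
    simp only [interlacing, Fintype.mem_piFinset] at hl ⊢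
    intro a
    by_cases ha : a.val < n
    · have := hl ⟨a, ha⟩
      rw [← hrange] at this
      simpa [extendZero, ha] using this
    · simp [entryRange, extendZero, ha]
  · intro f hf
    simp only [interlacing, Fintype.mem_piFinset] at hf ⊢
    intro i
    rw [← hrange]
    exact hf (Fin.castAdd h i)
  · intro l _
    funext i
    exact extendZero_coe l i
  · intro f hf
    simp only [Fintype.mem_piFinset] at hf
    funext a
    by_cases ha : a.val < n
    · simp [extendZero, ha]
    · have := hf a
      simp only [entryRange, ha, if_false, Finset.mem_singleton] at this
      simp [extendZero, ha, this]

theorem pf_gtMatrix_succ {gt : ℕ → MvPolynomial (Fin 2) ℚ} (hgt : gtChar gt) {h n m M : ℕ}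
    (hN : n + h = 2 * m) (hM : M = n + h + 2) (hM' : M = 2 * (m + 1)) {k : Fin (n + 1) → ℤ}
    (hk : Monotone k) :
    pf hM' (fun a b => gtMatrix gt (h + 1) (n + 1) (extendZero k) a b) =
      ∑ l ∈ interlacing k, pf hN (fun a b => gtMatrix gt h n (extendZero l) a b) := by
  subst hM
  have hk' : ∀ i < n, extendZero k i ≤ extendZero k (i + 1) := by
    intro i hi
    rw [extendZero, extendZero, dif_pos (by omega), dif_pos (by omega)]
    exact hk (by simp)
  have hskew : ∀ a b, gtMatrix gt (h + 1) (n + 1) (extendZero k) a b =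
      -gtMatrix gt (h + 1) (n + 1) (extendZero k) b a := fun a b => gtSkewEntry_skew ..
  have hone : ∀ a ≤ n, gtMatrix gt (h + 1) (n + 1) (extendZero k) a (n + h + 1) = 1 := by
    intro a ha
    rw [gtMatrix_of_lt _ _ _ _ (by omega), gtEntry, if_pos (by omega), if_neg (by omega),
      show h + 1 - 1 - (n + h + 1 - (n + 1)) = 0 by omega, qbinom_zero]
  have hzero : ∀ a, n < a → a ≤ n + h + 1 →
      gtMatrix gt (h + 1) (n + 1) (extendZero k) a (n + h + 1) = 0 := by
    intro a ha haN
    rcases haN.lt_or_eq with hlt | rfl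
    · rw [gtMatrix_of_lt _ _ _ _ hlt, gtEntry, if_neg (by omega)]
    · simp [gtMatrix, gtSkewEntry]
  rw [sum_interlacing_pf, pf_of_differences hN hM' (fun i => 1 ≤ i ∧ i ≤ n) (fun i => i - 1)
    (fun i hi => by omega) hskew (by omega) (hone 0 (by omega))]
  · congr 1
    refine skew_ext ?_ ?_ ?_
    · intro a b
      rw [hskew, hskew (a + 1) (b + 1 - 1), hskew (a + 1 - 1), hskew (a + 1 - 1) (b + 1 - 1)]
      split_ifs <;> ring
    · intro a b
      rw [Finset.sum_comm, ← Finset.sum_neg_distrib]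
      refine Finset.sum_congr rfl fun t _ => ?_
      rw [← Finset.sum_neg_distrib]
      exact Finset.sum_congr rfl fun s _ => gtSkewEntry_skew ..
    · intro a b hab
      have hab' : a.val < b.val := hab
      simp only [gtSkewEntry, hab', if_true]
      rw [sum_gtEntry hgt hk' hab' b.isLt]
      simp
  · intro a ha haN
    by_cases han : a ≤ n
    · rw [if_pos (by omega), hone a han, hone (a - 1) (by omega), sub_self]
    · rw [if_neg (by omega), hzero a (by omega) haN, sub_zero]

theorem monotone_of_mem_interlacing {n : ℕ} {k : Fin (n + 1) → ℤ} {l : Fin n → ℤ}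
    (hl : l ∈ interlacing k) (hk : Monotone k) : Monotone l := by
  simp only [interlacing, Fintype.mem_piFinset, Finset.mem_Icc] at hl
  intro i j hij
  rcases hij.lt_or_eq with hlt | rfl
  · exact (hl i).2.trans ((hk (by simpa [Fin.le_def, Nat.succ_le_iff] using hlt)).trans (hl j).1)
  · exact le_rfl

theorem GTcount_eq_pf {gt : ℕ → MvPolynomial (Fin 2) ℚ} (hgt : gtChar gt) {h n m : ℕ}
    (hhn : h ≤ n) (hN : n + h = 2 * m) {k : Fin n → ℤ} (hk : Monotone k) :
    (GTcount h n k : ℚ) = pf hN (fun a b => gtMatrix gt h n (extendZero k) a b) := by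
  induction h generalizing n m with
  | zero =>
    rw [GTcount_zero, Nat.cast_one, ← pf_one hN]
    congr 1
    funext a b
    have ha : a.val < n := a.isLt
    have hb : b.val < n := b.isLt
    simp [gtMatrix, gtSkewEntry, gtEntry, ha, hb, gtValue_zero hgt]
  | succ h ih =>
    obtain ⟨n, rfl⟩ : ∃ n', n = n' + 1 := ⟨n - 1, by omega⟩
    obtain ⟨m, rfl⟩ : ∃ m', m = m' + 1 := ⟨m - 1, by omega⟩
    have hN' : n + h = 2 * m := by omega
    rw [GTcount_succ (by omega), pf_gtMatrix_succ hgt hN' (by omega) hN hk, Nat.cast_sum]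
    exact Finset.sum_congr rfl fun l hl =>
      ih (by omega) hN' (monotone_of_mem_interlacing hl hk)

theorem pfUpper_eq_pf {N m : ℕ} (hN : N = 2 * m) (A : Fin N → Fin N → ℚ) :
    pfUpper N A = pf hN (skewExt A) := by
  obtain rfl : m = N / 2 := by omega
  simp only [pfUpper, pf, pfSum, smul_eq_mul, zsmul_eq_mul]
  rfl

/-- For `h ≤ n` with `h + n` even and weakly increasing integers
`k_1 ≤ … ≤ k_n`, the number `GT_h(k_1,…,k_n)` equals the Pfaffian of the upper triangular
array of order `n+h` with entries `gt_h(k_i+i, k_j+j)` (for `1 ≤ i < j ≤ n`),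
`binom(k_i+i, h-j)` (for `1 ≤ i ≤ n`, `1 ≤ j ≤ h`), and `0` (for `n < i < j ≤ n+h`). -/
theorem statement0 (h n : ℕ) (hhn : h ≤ n) (heven : Even (h + n))
    (k : Fin n → ℤ) (hk : Monotone k)
    (gt : ℕ → MvPolynomial (Fin 2) ℚ) (hgt : gtChar gt) :
    (GTcount h n k : ℚ) =
      pfUpper (n + h) (fun a b =>
        if ha : (a : ℕ) < n then
          if hb : (b : ℕ) < n then
            MvPolynomial.eval
              ![((k ⟨(a : ℕ), ha⟩ : ℤ) : ℚ) + ((a : ℕ) : ℚ) + 1,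
                ((k ⟨(b : ℕ), hb⟩ : ℤ) : ℚ) + ((b : ℕ) : ℚ) + 1] (gt h)
          else qbinom (((k ⟨(a : ℕ), ha⟩ : ℤ) : ℚ) + ((a : ℕ) : ℚ) + 1) (h - 1 - ((b : ℕ) - n))
        else 0) := by
  obtain ⟨m, hm⟩ := heven
  have hN : n + h = 2 * m := by omega
  rw [pfUpper_eq_pf hN, GTcount_eq_pf hgt hhn hN hk]
  congr 1
  have hentry : ∀ a b : Fin (n + h),
      gtEntry gt h n a (extendZero k a) b (extendZero k b) =
        if ha : (a : ℕ) < n then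
          if hb : (b : ℕ) < n then
            MvPolynomial.eval
              ![((k ⟨(a : ℕ), ha⟩ : ℤ) : ℚ) + ((a : ℕ) : ℚ) + 1,
                ((k ⟨(b : ℕ), hb⟩ : ℤ) : ℚ) + ((b : ℕ) : ℚ) + 1] (gt h)
          else qbinom (((k ⟨(a : ℕ), ha⟩ : ℤ) : ℚ) + ((a : ℕ) : ℚ) + 1) (h - 1 - ((b : ℕ) - n))
        else 0 := by
    intro a b
    by_cases ha : a.val < n
    · by_cases hb : b.val < n <;> simp [gtEntry, gtValue, extendZero, ha, hb, add_assoc]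
    · simp [gtEntry, ha]
  funext a b
  simp only [gtMatrix, gtSkewEntry, skewExt, hentry, Fin.lt_def]
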